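/- Let π be a finitely generated group, let φ: π → ℤ be a surjective homomorphism, and let π̃ ⊆ π be a subgroup of finite index with φ(π̃) = dℤ for a positive integer d; let φ̃: π̃ → ℤ satisfy φ = d·φ̃ on π̃ and set π̃_n := ker(π̃ → ℤ → ℤ/n) (via φ̃). If for every positive integer n the first Betti number satisfies b₁(π̃_n) ≥ n, then rg(π, φ) ≥ 1/(d·[π : π̃]) > 0. -/

import Mathlib

/-- The rank of a group: the minimal number of elements of a (finite) generating set.
(By convention `sInf ∅ = 0` for groups that are not finitely generated.) -/
noncomputable def rk (G : Type*) [Group G] : ℕ :=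
  sInf {n : ℕ | ∃ S : Finset G, S.card = n ∧ Subgroup.closure (S : Set G) = ⊤}

/-- `modKer φ n` is the subgroup `π_n`, the kernel of `φ : π → ℤ` followed by
reduction modulo `n`. -/
def modKer {π : Type*} [Group π] (φ : π →* Multiplicative ℤ) (n : ℕ) : Subgroup π :=
  ((AddMonoidHom.toMultiplicative (Int.castAddHom (ZMod n))).comp φ).ker

/-- The rank gradient of `(π, φ)` : the limit inferior of `rk(π_n)/n`. -/
noncomputable def rankGradient {π : Type*} [Group π] (φ : π →* Multiplicative ℤ) : ℝ :=
  Filter.atTop.liminf fun n : ℕ => (rk ↥(modKer φ n) : ℝ) / n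


open TensorProduct in
/-- The first Betti number of a group: the dimension over `ℚ` of the rationalized
abelianization `G^{ab} ⊗_ℤ ℚ`. -/
noncomputable def b1 (G : Type*) [Group G] : Cardinal :=
  Module.rank ℚ (ℚ ⊗[ℤ] Additive (Abelianization G))

/-- The rank of a finitely generated group agrees with Mathlib's `Group.rank`. -/
theorem rk_eq_rank (G : Type*) [Group G] [Group.FG G] : rk G = Group.rank G := by
  apply le_antisymm
  · exact Nat.sInf_le (Group.rank_spec G)
  · refine le_csInf ⟨_, Group.rank_spec G⟩ ?_
    rintro n ⟨S, rfl, hS⟩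
    exact Group.rank_le hS

open TensorProduct in
theorem rank_rat_tensor_le_card {M : Type*} [AddCommGroup M] {T : Set M}
    (hT : AddSubgroup.closure T = ⊤) :
    Module.rank ℚ (ℚ ⊗[ℤ] M) ≤ Cardinal.mk T := by
  have hspan : Submodule.span ℤ T = ⊤ := by
    rw [← Submodule.toAddSubgroup_inj, Submodule.span_int_eq_addSubgroupClosure, hT]
    rfl
  rw [← rank_top, ← Submodule.baseChange_top, ← hspan, Submodule.baseChange_span]
  refine (rank_span_le _).trans ?_
  exact Cardinal.mk_image_le

theorem b1_le_rank (G : Type*) [Group G] [Group.FG G] : b1 G ≤ (Group.rank G : Cardinal) := by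
  obtain ⟨S, hS, hS'⟩ := Group.rank_spec G
  have hT : AddSubgroup.closure
      (Additive.toMul ⁻¹' ((Abelianization.of : G →* _) '' (S : Set G))) = ⊤ := by
    rw [← Subgroup.toAddSubgroup_closure, ← MonoidHom.map_closure, hS',
      Subgroup.map_top_of_surjective Abelianization.of (QuotientGroup.mk'_surjective _)]
    rfl
  refine (rank_rat_tensor_le_card hT).trans ?_
  exact (Cardinal.mk_image_le (f := Abelianization.of) (s := (S : Set G))).trans (by simp [hS])

theorem mem_modKer {π : Type*} [Group π] (φ : π →* Multiplicative ℤ) (n : ℕ) (x : π) :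
    x ∈ modKer φ n ↔ (n : ℤ) ∣ Multiplicative.toAdd (φ x) :=
  ZMod.intCast_zmod_eq_zero_iff_dvd _ _

theorem modKer_index_le {π : Type*} [Group π] (φ : π →* Multiplicative ℤ) {n : ℕ} (hn : 0 < n) :
    (modKer φ n).index ≠ 0 ∧ (modKer φ n).index ≤ n := by
  have : NeZero n := ⟨hn.ne'⟩
  have : Finite (Multiplicative (ZMod n)) := inferInstanceAs (Finite (ZMod n))
  rw [modKer, Subgroup.index_ker]
  refine ⟨Nat.card_pos.ne', (Subgroup.card_le_card_group _).trans_eq ?_⟩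
  exact (Nat.card_congr Multiplicative.toAdd).trans (Nat.card_zmod n)

theorem Int.natCast_dvd_natCast_mul_iff {n : ℕ} (hn : 0 < n) (d : ℕ) (k : ℤ) :
    (n : ℤ) ∣ d * k ↔ ((n / n.gcd d : ℕ) : ℤ) ∣ k := by
  have hg : 0 < n.gcd d := Nat.gcd_pos_of_pos_left _ hn
  rw [Int.natCast_dvd, Int.natCast_dvd, Int.natAbs_mul, Int.natAbs_natCast]
  nth_rw 1 [← Nat.div_mul_cancel (n.gcd_dvd_left d)]
  nth_rw 3 [← Nat.div_mul_cancel (n.gcd_dvd_right d)]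
  rw [mul_right_comm, Nat.mul_dvd_mul_iff_right hg]
  exact (Nat.coprime_div_gcd_div_gcd hg).dvd_mul_left

theorem b1_modKer_le {π : Type*} [Group π] [Group.FG π] (φ : π →* Multiplicative ℤ)
    (Γ : Subgroup π) [Γ.FiniteIndex] (d : ℕ) (φt : ↥Γ →* Multiplicative ℤ)
    (hφt : ∀ x : Γ, Multiplicative.toAdd (φ (x : π)) = (d : ℤ) * Multiplicative.toAdd (φt x))
    {n : ℕ} (hn : 0 < n) :
    b1 (modKer φt (n / n.gcd d)) ≤ ((Γ.index * rk (modKer φ n) : ℕ) : Cardinal) := by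
  have : (modKer φ n).FiniteIndex := ⟨(modKer_index_le φ hn).1⟩
  have hmod : modKer φt (n / n.gcd d) = (modKer φ n).subgroupOf Γ := by
    ext x
    rw [mem_modKer, Subgroup.mem_subgroupOf, mem_modKer, hφt,
      Int.natCast_dvd_natCast_mul_iff hn]
  have : Group.FG Γ := Γ.fg_of_index_ne_zero
  have : Group.FG (modKer φ n) := (modKer φ n).fg_of_index_ne_zero
  have : Group.FG ((modKer φ n).subgroupOf Γ) := Subgroup.fg_of_index_ne_zero _
  have : Group.FG (Γ.subgroupOf (modKer φ n)) := Subgroup.fg_of_index_ne_zero _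
  let f : Γ.subgroupOf (modKer φ n) →* (modKer φ n).subgroupOf Γ :=
    { toFun := fun x => ⟨⟨x.1.1, x.2⟩, x.1.2⟩
      map_one' := rfl
      map_mul' := fun _ _ => rfl }
  have hf : Function.Surjective f := fun y => ⟨⟨⟨y.1.1, y.2⟩, y.1.2⟩, rfl⟩
  rw [hmod, rk_eq_rank]
  refine (b1_le_rank _).trans (Nat.cast_le.2 ?_)
  calc Group.rank ((modKer φ n).subgroupOf Γ)
      ≤ Group.rank (Γ.subgroupOf (modKer φ n)) := Group.rank_le_of_surjective f hf
    _ ≤ (Γ.subgroupOf (modKer φ n)).index * Group.rank (modKer φ n) :=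
        Subgroup.rank_le_index_mul_rank _
    _ ≤ Γ.index * Group.rank (modKer φ n) := by
        gcongr
        rw [← Γ.relIndex_top_right]
        exact Subgroup.relIndex_le_of_le_right le_top
          (by rw [Γ.relIndex_top_right]; exact Subgroup.FiniteIndex.index_ne_zero)

theorem rk_modKer_div_le {π : Type*} [Group π] [Group.FG π] (φ : π →* Multiplicative ℤ) (n : ℕ) :
    (rk (modKer φ n) : ℝ) / n ≤ Group.rank π := by
  rcases n.eq_zero_or_pos with rfl | hn
  · simp
  have : (modKer φ n).FiniteIndex := ⟨(modKer_index_le φ hn).1⟩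
  have : Group.FG (modKer φ n) := (modKer φ n).fg_of_index_ne_zero
  rw [rk_eq_rank, div_le_iff₀' (by exact_mod_cast hn)]
  exact_mod_cast (Subgroup.rank_le_index_mul_rank (modKer φ n)).trans
    (Nat.mul_le_mul_right _ (modKer_index_le φ hn).2)

/-- Let `π` be finitely generated, `φ : π → ℤ` surjective, `π̃ = Γ` a finite-index
subgroup with `φ(Γ) = dℤ` (`d > 0`), and `φ̃ = φt` with `φ = d·φ̃` on `Γ`.  If
`b₁(π̃_n) ≥ n` for all positive `n`, then `rg(π, φ) ≥ 1/(d·[π : π̃]) > 0`. -/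
theorem rankGradient_pos_of_b1_ge
    {π : Type*} [Group π] [Group.FG π] (φ : π →* Multiplicative ℤ)
    (hφ : Function.Surjective φ) (Γ : Subgroup π) [Γ.FiniteIndex]
    (d : ℕ) (hd : 0 < d)
    (hrange : (φ.comp Γ.subtype).range = Subgroup.zpowers (Multiplicative.ofAdd (d : ℤ)))
    (φt : ↥Γ →* Multiplicative ℤ)
    (hφt : ∀ x : Γ, Multiplicative.toAdd (φ (x : π)) = (d : ℤ) * Multiplicative.toAdd (φt x))
    (hb : ∀ n : ℕ, 0 < n → (n : Cardinal) ≤ b1 ↥(modKer φt n)) :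
    1 / ((d : ℝ) * (Γ.index : ℝ)) ≤ rankGradient φ ∧ 0 < rankGradient φ := by
  have hi : 0 < Γ.index := Nat.pos_of_ne_zero Subgroup.FiniteIndex.index_ne_zero
  have hpos : 0 < 1 / ((d : ℝ) * (Γ.index : ℝ)) := by positivity
  suffices h : 1 / ((d : ℝ) * (Γ.index : ℝ)) ≤ rankGradient φ from ⟨h, hpos.trans_le h⟩
  refine Filter.le_liminf_of_le
    (Filter.isCoboundedUnder_ge_of_le _ (rk_modKer_div_le φ)) ?_
  filter_upwards [Filter.eventually_gt_atTop 0] with n hn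
  have hgn : n / n.gcd d * n.gcd d = n := Nat.div_mul_cancel (n.gcd_dvd_left d)
  have hm : 0 < n / n.gcd d :=
    Nat.div_pos (Nat.gcd_le_left _ hn) (Nat.gcd_pos_of_pos_left _ hn)
  have hle : n / n.gcd d ≤ Γ.index * rk (modKer φ n) :=
    Nat.cast_le.1 ((hb _ hm).trans (b1_modKer_le φ Γ d φt hφt hn))
  have hnle : n ≤ rk (modKer φ n) * (d * Γ.index) := calc
    n = n / n.gcd d * n.gcd d := hgn.symm
    _ ≤ Γ.index * rk (modKer φ n) * d := Nat.mul_le_mul hle (Nat.gcd_le_right _ hd)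
    _ = rk (modKer φ n) * (d * Γ.index) := by ring
  rw [div_le_div_iff₀ (by positivity) (by exact_mod_cast hn), one_mul]
  exact_mod_cast hnle
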